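/- arXiv:2601.16025 — 4 statements merged into one kernel-verified Lean document; each statement's English description precedes it below -/
import Mathlib

section
/- Let r be a finite relation instance over a finite attribute set R, let A ∈ R, and let X ⊆ R with A ∉ X. Then the functional dependency X → A holds on r (i.e., for all tuples t₁, t₂ ∈ r, t₁ and t₂ agreeing on every attribute of X implies they agree on A) if and only if X is a hitting set of the sub-hypergraph H_A, i.e., X has nonempty intersection with every set of the form D(t₁,t₂) \ {A} where t₁, t₂ ∈ r differ on attribute A. -/
/-- An FD `X → A` holds on a relation instance `r` iff any two tuples agreeing on
every attribute of `X` also agree on `A`. -/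
def FDHolds {α V : Type*} (r : Set (α → V)) (X : Set α) (A : α) : Prop :=
  ∀ t₁ ∈ r, ∀ t₂ ∈ r, (∀ B ∈ X, t₁ B = t₂ B) → t₁ A = t₂ A

/-- The difference set of two tuples: the attributes of `R` on which they differ. -/
def DiffSet {α V : Type*} (R : Set α) (t₁ t₂ : α → V) : Set α :=
  {B ∈ R | t₁ B ≠ t₂ B}

/-- Edge set `D_r^A` of the sub-hypergraph of attribute `A`:
difference sets of tuple pairs differing on `A`, with `A` removed. -/
def SubEdges {α V : Type*} (R : Set α) (r : Set (α → V)) (A : α) : Set (Set α) :=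
  {e | ∃ t₁ ∈ r, ∃ t₂ ∈ r, t₁ A ≠ t₂ A ∧ e = DiffSet R t₁ t₂ \ {A}}

/-- `X` is a hitting set of the edge collection `E` iff it intersects every edge. -/
def IsHS {α : Type*} (E : Set (Set α)) (X : Set α) : Prop :=
  ∀ e ∈ E, (X ∩ e).Nonempty

theorem stmt0 {α V : Type*} (R : Set α) (hRfin : R.Finite)
    (r : Set (α → V)) (hrfin : r.Finite)
    (A : α) (hA : A ∈ R) (X : Set α) (hXR : X ⊆ R) (hAX : A ∉ X) :
    FDHolds r X A ↔ IsHS (SubEdges R r A) X := by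
  constructor
  · rintro h _ ⟨t₁, h₁, t₂, h₂, hne, rfl⟩
    by_contra hempty
    refine hne (h t₁ h₁ t₂ h₂ fun B hB => ?_)
    by_contra hBne
    exact hempty ⟨B, hB, ⟨hXR hB, hBne⟩, fun hBA => hAX (hBA ▸ hB)⟩
  · intro h t₁ h₁ t₂ h₂ hagree
    by_contra hne
    obtain ⟨B, hB, ⟨_, hBne⟩, _⟩ := h _ ⟨t₁, h₁, t₂, h₂, hne, rfl⟩
    exact hBne (hagree B hB)
end

section
/- Let r be a finite relation instance over a finite attribute set R, let A ∈ R, and let X ⊆ R with A ∉ X. Then X → A is a minimal non-trivial FD on r (i.e., X → A holds on r and no proper subset X' ⊂ X satisfies X' → A on r) if and only if X is a minimal hitting set of the sub-hypergraph H_A, i.e., X intersects every edge of D_r^A and no proper subset of X intersects every edge of D_r^A. -/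
/-- `X` is a minimal hitting set of `E` iff it is a hitting set and no proper
subset of `X` is a hitting set. -/
def IsMinHS {α : Type*} (E : Set (Set α)) (X : Set α) : Prop :=
  IsHS E X ∧ ∀ Y ⊂ X, ¬ IsHS E Y

/-- For `X ⊆ R` not containing `A`, the FD `X → A` holds iff `X` hits every edge of the
sub-hypergraph of `A`. -/
theorem fdHolds_iff_isHS {α V : Type*} {R : Set α} {r : Set (α → V)} {A : α} {X : Set α}
    (hXR : X ⊆ R) (hAX : A ∉ X) : FDHolds r X A ↔ IsHS (SubEdges R r A) X := by
  constructor
  · rintro h _ ⟨t₁, h₁, t₂, h₂, hne, rfl⟩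
    by_contra hempty
    refine hne (h t₁ h₁ t₂ h₂ fun B hB => ?_)
    by_contra hBne
    exact hempty ⟨B, hB, ⟨hXR hB, hBne⟩, fun hBA => hAX (hBA ▸ hB)⟩
  · intro h t₁ h₁ t₂ h₂ hagree
    by_contra hne
    obtain ⟨B, hB, ⟨-, hBne⟩, -⟩ := h _ ⟨t₁, h₁, t₂, h₂, hne, rfl⟩
    exact hBne (hagree B hB)

theorem stmt1 {α V : Type*} (R : Set α) (hRfin : R.Finite)
    (r : Set (α → V)) (hrfin : r.Finite)
    (A : α) (hA : A ∈ R) (X : Set α) (hXR : X ⊆ R) (hAX : A ∉ X) :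
    (FDHolds r X A ∧ ∀ X' ⊂ X, ¬ FDHolds r X' A) ↔ IsMinHS (SubEdges R r A) X := by
  exact and_congr (fdHolds_iff_isHS hXR hAX) (forall₂_congr fun _ hY =>
    not_congr (fdHolds_iff_isHS (hY.subset.trans hXR) fun hA' => hAX (hY.subset hA')))
end

section
/- Let r and Δr be finite relation instances over a finite attribute set R, let A ∈ R, X ⊆ R, and B ∈ X. Let r' = {t ∈ r | there exists t' ∈ Δr with t B = t' B} be the union of blocks of r whose B-value occurs in Δr. Then the FD X → A holds on r ∪ Δr if and only if X → A holds on r and X → A holds on Δr ∪ r'. In particular, any cross violated pair t₁ ∈ r, t₂ ∈ Δr satisfies t₁ B = t₂ B, so t₁ lies in r'. -/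
/-- The union of blocks of `r` whose `B`-value occurs in `Δr`. -/
def RelevantBlocks {α V : Type*} (r Δr : Set (α → V)) (B : α) : Set (α → V) :=
  {t ∈ r | ∃ t' ∈ Δr, t B = t' B}

/-- A functional dependency is inherited by subinstances. -/
theorem FDHolds.mono {α V : Type*} {r s : Set (α → V)} {X : Set α} {A : α}
    (h : FDHolds s X A) (hrs : r ⊆ s) : FDHolds r X A :=
  fun t₁ ht₁ t₂ ht₂ => h t₁ (hrs ht₁) t₂ (hrs ht₂)

/-- A tuple of `r` agreeing on `X` with a tuple of `Δr` lies in a relevant block. -/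
theorem mem_relevantBlocks {α V : Type*} {r Δr : Set (α → V)} {X : Set α} {B : α}
    (hB : B ∈ X) {t₁ t₂ : α → V} (ht₁ : t₁ ∈ r) (ht₂ : t₂ ∈ Δr)
    (hX : ∀ C ∈ X, t₁ C = t₂ C) : t₁ ∈ RelevantBlocks r Δr B :=
  ⟨ht₁, t₂, ht₂, hX B hB⟩

theorem stmt13 {α V : Type*} (R : Set α) (hRfin : R.Finite)
    (r Δr : Set (α → V)) (hrfin : r.Finite) (hΔfin : Δr.Finite)
    (A : α) (hA : A ∈ R) (X : Set α) (hXR : X ⊆ R)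
    (B : α) (hB : B ∈ X) :
    (FDHolds (r ∪ Δr) X A ↔
      FDHolds r X A ∧ FDHolds (Δr ∪ RelevantBlocks r Δr B) X A) ∧
    (∀ t₁ ∈ r, ∀ t₂ ∈ Δr, (∀ C ∈ X, t₁ C = t₂ C) → t₁ A ≠ t₂ A →
      t₁ B = t₂ B ∧ t₁ ∈ RelevantBlocks r Δr B) := by
  refine ⟨⟨fun h => ⟨h.mono Set.subset_union_left, h.mono ?_⟩, ?_⟩, ?_⟩
  · exact Set.union_subset Set.subset_union_right
      (fun t ht => Set.mem_union_left _ (Set.sep_subset _ _ ht))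
  · rintro ⟨h₁, h₂⟩ t₁ (ht₁ | ht₁) t₂ (ht₂ | ht₂) hX
    · exact h₁ t₁ ht₁ t₂ ht₂ hX
    · exact h₂ t₁ (Or.inr (mem_relevantBlocks hB ht₁ ht₂ hX)) t₂ (Or.inl ht₂) hX
    · exact h₂ t₁ (Or.inl ht₁) t₂
        (Or.inr (mem_relevantBlocks hB ht₂ ht₁ fun C hC => (hX C hC).symm)) hX
    · exact h₂ t₁ (Or.inl ht₁) t₂ (Or.inl ht₂) hX
  · exact fun t₁ ht₁ t₂ ht₂ hX _ => ⟨hX B hB, mem_relevantBlocks hB ht₁ ht₂ hX⟩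
end

section
/- Let r and Δr be finite relation instances over a finite attribute set R, let A ∈ R, X ⊆ R, and let f be a hash function on X-projections that is injective on equivalence classes with respect to X over r ∪ Δr. Define the full mapping set MHT(X → A) = {(f(t restricted to X), t A) | t ∈ r} and MHT_Δ(X → A) = {(f(t restricted to X), t A) | t ∈ Δr}. If X → A holds on r, X → A holds on Δr, and MHT_Δ(X → A) ⊆ MHT(X → A), then X → A holds on r ∪ Δr. -/
/-- The projection of a tuple `t` to the attribute set `X`. -/
def Proj {α V : Type*} (X : Set α) (t : α → V) : X → V :=
  fun b => t b.1

/-- The multi-attribute hash table of an instance: the set of mapping items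
`(f(t|X), t A)` over its tuples `t`. -/
def MHT {α V K : Type*} (r : Set (α → V)) (X : Set α) (A : α)
    (f : (X → V) → K) : Set (K × V) :=
  {p | ∃ t ∈ r, p = (f (Proj X t), t A)}

theorem stmt15 {α V K : Type*} (R : Set α) (hRfin : R.Finite)
    (r Δr : Set (α → V)) (hrfin : r.Finite) (hΔfin : Δr.Finite)
    (A : α) (hA : A ∈ R) (X : Set α) (hXR : X ⊆ R)
    (f : (X → V) → K)
    (hf : ∀ t₁ ∈ r ∪ Δr, ∀ t₂ ∈ r ∪ Δr,
      (f (Proj X t₁) = f (Proj X t₂) ↔ ∀ B ∈ X, t₁ B = t₂ B))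
    (h1 : FDHolds r X A) (h2 : FDHolds Δr X A)
    (h3 : MHT Δr X A f ⊆ MHT r X A f) :
    FDHolds (r ∪ Δr) X A := by
  have key : ∀ t ∈ r ∪ Δr, ∃ s ∈ r, (∀ B ∈ X, t B = s B) ∧ t A = s A := by
    rintro t (ht | ht)
    · exact ⟨t, ht, fun _ _ => rfl, rfl⟩
    · obtain ⟨s, hs, heq⟩ := h3 ⟨t, ht, rfl⟩
      obtain ⟨hK, hV⟩ := Prod.mk.inj heq
      exact ⟨s, hs, (hf t (Or.inr ht) s (Or.inl hs)).mp hK, hV⟩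
  intro t₁ ht₁ t₂ ht₂ h
  obtain ⟨s₁, hs₁, hX₁, hA₁⟩ := key t₁ ht₁
  obtain ⟨s₂, hs₂, hX₂, hA₂⟩ := key t₂ ht₂
  rw [hA₁, hA₂]
  exact h1 s₁ hs₁ s₂ hs₂ fun B hB => by rw [← hX₁ B hB, ← hX₂ B hB, h B hB]
end
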